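/- Let M ∈ ℕ, let 𝒢 = (G_1, …, G_G) be a partition of Fin M into G nonempty pairwise disjoint groups whose union is Fin M, and let v : Finset (Fin M) → ℝ be separable over 𝒢. Let 𝒯_0 and 𝒯_AB be two disjoint sub-collections of the groups of 𝒢, and let S_0 ⊆ ⋃𝒯_0, S_A ⊆ ⋃𝒯_AB, and S_B ⊆ ⋃𝒯_AB be feature subsets. Then v(S_0 ∪ S_A) − v(S_0 ∪ S_B) = v(S_A) − v(S_B). (Lemma A.1, contribution function identity.) -/

import Mathlib

open Finset

theorem inter_eq_empty_of_subset_biUnion {ι α : Type*} [DecidableEq α] {G : ι → Finset α}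
    (hdisj : ∀ i j : ι, i ≠ j → Disjoint (G i) (G j)) {T : Finset ι} {S : Finset α}
    (hS : S ⊆ T.biUnion G) {i : ι} (hi : i ∉ T) : S ∩ G i = ∅ := by
  rw [← disjoint_iff_inter_eq_empty]
  refine Disjoint.mono_left hS ((disjoint_biUnion_left T G (G i)).2 fun j hj => hdisj j i ?_)
  rintro rfl
  exact hi hj

/-- Lemma A.1 (contribution function identity): if `v` is separable over the partition `G`,
`T0` and `TAB` are disjoint sub-collections of groups, `S0 ⊆ ⋃ T0`, and
`SA, SB ⊆ ⋃ TAB`, then `v (S0 ∪ SA) - v (S0 ∪ SB) = v SA - v SB`. -/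
theorem contribution_function_identity
    (M Gn : ℕ) (G : Fin Gn → Finset (Fin M))
    (hne : ∀ i, (G i).Nonempty)
    (hdisj : ∀ i j : Fin Gn, i ≠ j → Disjoint (G i) (G j))
    (hcover : Finset.univ.biUnion G = (Finset.univ : Finset (Fin M)))
    (v : Finset (Fin M) → ℝ)
    (hsep : ∃ w : Fin Gn → Finset (Fin M) → ℝ,
      ∀ S : Finset (Fin M), v S = ∑ i, w i (S ∩ G i))
    (T0 TAB : Finset (Fin Gn)) (hT : Disjoint T0 TAB)
    (S0 SA SB : Finset (Fin M))
    (hS0 : S0 ⊆ T0.biUnion G) (hSA : SA ⊆ TAB.biUnion G) (hSB : SB ⊆ TAB.biUnion G) :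
    v (S0 ∪ SA) - v (S0 ∪ SB) = v SA - v SB := by
  obtain ⟨w, hw⟩ := hsep
  simp only [hw, ← sum_sub_distrib, union_inter_distrib_right]
  refine sum_congr rfl fun i _ => ?_
  by_cases hi : i ∈ T0
  · have hi' : i ∉ TAB := disjoint_left.1 hT hi
    simp [inter_eq_empty_of_subset_biUnion hdisj hSA hi',
      inter_eq_empty_of_subset_biUnion hdisj hSB hi']
  · simp [inter_eq_empty_of_subset_biUnion hdisj hS0 hi]
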